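/- Let T be a compact H-operator with constant C on an infinite-dimensional complex Banach space X, and let (λ_n(T))_{n≥1} be an enumeration of its eigenvalues ordered by nonincreasing modulus and counted with algebraic multiplicity. Then for every n ≥ 1: δ_{n−1}(T) ≤ α_n(T) ≤ 2√2 · C · |λ_n(T)| ≤ 8C(C + 1) · δ_{n−1}(T). -/

import Mathlib

open scoped ENNReal

section Defs

variable {X Y : Type*} [NormedAddCommGroup X] [NormedSpace ℂ X]
  [NormedAddCommGroup Y] [NormedSpace ℂ Y]

/-- `approxNumber T n` is the `(n+1)`-st approximation number `α_{n+1}(T)`, i.e. the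
distance of `T` to the operators of rank `≤ n`. -/
noncomputable def approxNumber (T : X →L[ℂ] Y) (n : ℕ) : ℝ :=
  sInf {c : ℝ | ∃ A : X →L[ℂ] Y, Module.rank ℂ (LinearMap.range A.toLinearMap) ≤ (n : Cardinal) ∧
    c = ‖T - A‖}

/-- The canonical quotient map `X → X ⧸ G` as a continuous linear map. -/
noncomputable def quotMapL (G : Submodule ℂ X) : X →L[ℂ] X ⧸ G :=
  G.mkQ.mkContinuous 1 fun x => by
    simpa using Submodule.Quotient.norm_mk_le G x

/-- `kolmogorovDiameter T n` is the `n`-th Kolmogorov diameter `δ_n(T)` of an operator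
`T : X → X`: the infimum of `‖Q_G ∘ T‖` over subspaces `G ⊆ X` with `dim G ≤ n`. -/
noncomputable def kolmogorovDiameter (T : X →L[ℂ] X) (n : ℕ) : ℝ :=
  sInf {c : ℝ | ∃ G : Submodule ℂ X, Module.rank ℂ G ≤ (n : Cardinal) ∧
    c = ‖(quotMapL G).comp T‖}

/-- `T` is an H-operator with constant `C`: its spectrum is real and
`‖(T - λI)⁻¹‖ ≤ C * |Im λ|⁻¹` whenever `Im λ ≠ 0`. -/
def IsHOperator (T : X →L[ℂ] X) (C : ℝ) : Prop :=
  (∀ z ∈ spectrum ℂ T, z.im = 0) ∧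
  ∀ lam : ℂ, lam.im ≠ 0 →
    ∃ S : X →L[ℂ] X, S.comp (T - lam • (1 : X →L[ℂ] X)) = 1 ∧
      (T - lam • (1 : X →L[ℂ] X)).comp S = 1 ∧ ‖S‖ ≤ C * |lam.im|⁻¹

/-- The algebraic multiplicity of `μ` for `T`: the dimension of
`⋃_k ker (T - μI)^k`. -/
noncomputable def algebraicMultiplicity (T : X →L[ℂ] X) (μ : ℂ) : ℕ :=
  Module.finrank ℂ
    (⨆ k : ℕ, LinearMap.ker ((T - μ • (1 : X →L[ℂ] X)) ^ k).toLinearMap : Submodule ℂ X)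

/-- `lam` enumerates the eigenvalues of the compact operator `T` in order of
nonincreasing modulus, counted with algebraic multiplicity: `|lam 0| ≥ |lam 1| ≥ ⋯`,
each term is zero or a spectral value, every nonzero `μ` occurs exactly
`d(μ) = dim ⋃_k ker (T - μI)^k` times (in particular `lam n = 0` for the remaining
indices if there are only finitely many nonzero eigenvalues), and every nonzero
point of the spectrum occurs.  Here `lam n` stands for `λ_{n+1}(T)`. -/
def IsEigenvalueEnumeration (T : X →L[ℂ] X) (lam : ℕ → ℂ) : Prop :=
  (∀ n : ℕ, ‖lam (n + 1)‖ ≤ ‖lam n‖) ∧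
  (∀ n : ℕ, lam n = 0 ∨ lam n ∈ spectrum ℂ T) ∧
  (∀ μ : ℂ, μ ≠ 0 →
    {n : ℕ | lam n = μ}.Finite ∧ {n : ℕ | lam n = μ}.ncard = algebraicMultiplicity T μ) ∧
  (∀ μ ∈ spectrum ℂ T, μ ≠ 0 → ∃ n : ℕ, lam n = μ)

end Defs

section GeneralizedEigenspaces

open Module Module.End

variable {V : Type*} [AddCommGroup V] [Module ℂ V] (f : End ℂ V)

/-- The span of the generalized eigenspaces of `f` belonging to a finite set of scalars. -/
noncomputable def genEigenspan (S : Finset ℂ) : Submodule ℂ V := S.sup f.maxGenEigenspace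

variable {f}

theorem maxGenEigenspace_le_genEigenspan {S : Finset ℂ} {μ : ℂ} (hμ : μ ∈ S) :
    f.maxGenEigenspace μ ≤ genEigenspan f S :=
  Finset.le_sup (f := f.maxGenEigenspace) hμ

theorem disjoint_genEigenspan {S : Finset ℂ} {μ : ℂ} (hμ : μ ∉ S) :
    Disjoint (f.maxGenEigenspace μ) (genEigenspan f S) := by
  rw [genEigenspan, Finset.sup_eq_iSup]
  exact f.independent_maxGenEigenspace.disjoint_biSup (y := (S : Set ℂ)) (by simpa using hμ)

theorem finiteDimensional_genEigenspan {S : Finset ℂ}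
    (hS : ∀ μ ∈ S, FiniteDimensional ℂ (f.maxGenEigenspace μ)) :
    FiniteDimensional ℂ (genEigenspan f S) := by
  classical
  induction S using Finset.induction_on with
  | empty => rw [genEigenspan, Finset.sup_empty]; infer_instance
  | insert μ S hμ ih =>
    have := hS μ (by simp)
    have := ih fun ν hν => hS ν (by simp [hν])
    rw [genEigenspan, Finset.sup_insert]
    rw [genEigenspan] at this
    infer_instance

theorem finrank_genEigenspan {S : Finset ℂ}
    (hS : ∀ μ ∈ S, FiniteDimensional ℂ (f.maxGenEigenspace μ)) :
    finrank ℂ (genEigenspan f S) = ∑ μ ∈ S, finrank ℂ (f.maxGenEigenspace μ) := by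
  classical
  induction S using Finset.induction_on with
  | empty => rw [genEigenspan, Finset.sup_empty]; simp
  | insert μ S hμ ih =>
    have hS' : ∀ ν ∈ S, FiniteDimensional ℂ (f.maxGenEigenspace ν) :=
      fun ν hν => hS ν (by simp [hν])
    have := hS μ (by simp)
    have := finiteDimensional_genEigenspan hS'
    have h := Submodule.finrank_sup_add_finrank_inf_eq (f.maxGenEigenspace μ) (genEigenspan f S)
    rw [(disjoint_genEigenspan hμ).eq_bot, finrank_bot, add_zero, ih hS'] at h
    rw [Finset.sum_insert hμ, ← h, genEigenspan, Finset.sup_insert]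
    rfl

theorem apply_mem_genEigenspan {S : Finset ℂ} {x : V} (hx : x ∈ genEigenspan f S) :
    f x ∈ genEigenspan f S := by
  suffices genEigenspan f S ≤ (genEigenspan f S).comap f from this hx
  refine Finset.sup_le fun μ hμ x hx => ?_
  exact maxGenEigenspace_le_genEigenspan hμ
    (f.mapsTo_maxGenEigenspace_of_comm (Commute.refl f) μ hx)

theorem eq_zero_of_mem_genEigenspan {S : Finset ℂ} {μ : ℂ} (hμ : μ ∉ S) {x : V}
    (hx : x ∈ genEigenspan f S) (h : f x = μ • x) : x = 0 := by
  have h1 : x ∈ f.maxGenEigenspace μ :=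
    f.eigenspace_le_maxGenEigenspace (mem_eigenspace_iff.2 h)
  exact Submodule.disjoint_def.1 (disjoint_genEigenspan hμ) x h1 hx

theorem exists_sub_smul_eq_of_mem_genEigenspan {S : Finset ℂ}
    (hS : ∀ μ ∈ S, FiniteDimensional ℂ (f.maxGenEigenspace μ)) {μ : ℂ} (hμ : μ ∉ S) {a : V}
    (ha : a ∈ genEigenspan f S) : ∃ y ∈ genEigenspan f S, f y - μ • y = a := by
  have := finiteDimensional_genEigenspan hS
  have hmaps : ∀ x ∈ genEigenspan f S, (f - μ • 1) x ∈ genEigenspan f S := fun x hx =>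
    Submodule.sub_mem _ (apply_mem_genEigenspan hx) (Submodule.smul_mem _ μ hx)
  have hinj : Function.Injective ((f - μ • 1).restrict hmaps) := by
    rw [injective_iff_map_eq_zero]
    intro x hx
    have hx' : f x - μ • (x : V) = 0 := congrArg Subtype.val hx
    exact Subtype.ext (eq_zero_of_mem_genEigenspan hμ x.2 (sub_eq_zero.1 hx'))
  obtain ⟨y, hy⟩ := LinearMap.injective_iff_surjective.1 hinj ⟨a, ha⟩
  exact ⟨y, y.2, congrArg Subtype.val hy⟩

/-- If `S` contains `μ` or `μ` is not an eigenvalue, then `μ` is not an eigenvalue of the map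
induced by `f` on the quotient by `genEigenspan f S`. -/
theorem mem_genEigenspan_of_sub_smul_mem {S : Finset ℂ}
    (hS : ∀ μ ∈ S, FiniteDimensional ℂ (f.maxGenEigenspace μ)) {μ : ℂ}
    (hμ : μ ∈ S ∨ ¬ f.HasEigenvalue μ) {x : V} (hx : f x - μ • x ∈ genEigenspan f S) :
    x ∈ genEigenspan f S := by
  classical
  by_cases hμS : μ ∈ S
  · have hsup : genEigenspan f S = f.maxGenEigenspace μ ⊔ genEigenspan f (S.erase μ) := by
      conv_lhs => rw [← Finset.insert_erase hμS, genEigenspan, Finset.sup_insert]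
      rfl
    rw [hsup] at hx ⊢
    obtain ⟨a, ha, b, hb, hab⟩ := Submodule.mem_sup.1 hx
    obtain ⟨y, hy, hyb⟩ := exists_sub_smul_eq_of_mem_genEigenspan
      (fun ν hν => hS ν (Finset.mem_of_mem_erase hν)) (Finset.notMem_erase μ S) hb
    have hxy : x - y ∈ f.maxGenEigenspace μ := by
      obtain ⟨k, hk⟩ := (f.mem_maxGenEigenspace μ a).1 ha
      refine (f.mem_maxGenEigenspace μ _).2 ⟨k + 1, ?_⟩
      have : (f - μ • (1 : End ℂ V)) (x - y) = a := by
        simp only [map_sub, LinearMap.sub_apply, LinearMap.smul_apply, End.one_apply]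
        rw [hyb, ← hab]; abel
      rw [pow_succ, Module.End.mul_apply, this, hk]
    exact Submodule.mem_sup.2 ⟨x - y, hxy, y, hy, by abel⟩
  · have hne := hμ.resolve_left hμS
    obtain ⟨y, hy, hyx⟩ := exists_sub_smul_eq_of_mem_genEigenspan hS hμS hx
    have hxy : x - y ∈ f.eigenspace μ := by
      rw [mem_eigenspace_iff, map_sub, smul_sub, sub_eq_sub_iff_sub_eq_sub, hyx]
    rw [End.hasEigenvalue_iff, not_not] at hne
    rw [hne, Submodule.mem_bot, sub_eq_zero] at hxy
    exact hxy ▸ hy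

end GeneralizedEigenspaces

section WeightedCircleIntegral

open Complex Metric

variable {F G : Type*} [NormedAddCommGroup F] [NormedSpace ℂ F]
  [NormedAddCommGroup G] [NormedSpace ℂ G]

/-- The Cauchy integral for the derivative at `0` with the kernel `z⁻²` replaced by `z⁻² - R⁻²`,
which vanishes at the real points `±R` of the circle. -/
noncomputable def realVanishingCauchyIntegral (R : ℝ) (f : ℂ → F) : F :=
  (2 * Real.pi * I : ℂ)⁻¹ • ∮ z in C(0, R), ((z ^ 2)⁻¹ - ((R : ℂ) ^ 2)⁻¹) • f z

theorem norm_kernel_eq {R : ℝ} (hR : 0 < R) {z : ℂ} (hz : ‖z‖ = R) :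
    ‖(z ^ 2)⁻¹ - ((R : ℂ) ^ 2)⁻¹‖ = 2 * |z.im| / R ^ 3 := by
  have hz0 : z ≠ 0 := by
    rintro rfl
    simp at hz
    exact hR.ne hz
  have hR0 : (R : ℂ) ≠ 0 := by exact_mod_cast hR.ne'
  have hRz : (R : ℂ) ^ 2 = z * (starRingEnd ℂ) z := by
    rw [mul_conj, normSq_eq_norm_sq, hz]; push_cast; rfl
  have h : (z ^ 2)⁻¹ - ((R : ℂ) ^ 2)⁻¹ = ((starRingEnd ℂ) z - z) / (z * (R : ℂ) ^ 2) := by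
    have hc : (starRingEnd ℂ) z = (R : ℂ) ^ 2 / z := by rw [hRz]; field_simp
    rw [hc]
    field_simp
  have h2 : ‖(starRingEnd ℂ) z - z‖ = 2 * |z.im| := by
    rw [norm_sub_rev, sub_conj]
    simp
  rw [h, norm_div, h2, norm_mul, norm_pow, hz]
  simp only [norm_real, Real.norm_eq_abs, abs_of_pos hR]
  congr 1
  ring

theorem norm_realVanishingCauchyIntegral_le {R M : ℝ} (hR : 0 < R) (hM : 0 ≤ M) {f : ℂ → F}
    (hf : ∀ z : ℂ, ‖z‖ = R → z.im ≠ 0 → ‖f z‖ ≤ M * |z.im|⁻¹) :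
    ‖realVanishingCauchyIntegral R f‖ ≤ 2 * M / R ^ 2 := by
  have h := circleIntegral.norm_two_pi_i_inv_smul_integral_le_of_norm_le_const
    (f := fun z => ((z ^ 2)⁻¹ - ((R : ℂ) ^ 2)⁻¹) • f z) (c := 0) (R := R) (C := 2 * M / R ^ 3)
    hR.le (fun z hz => by
      have hz' : ‖z‖ = R := by simpa using hz
      rw [norm_smul, norm_kernel_eq hR hz']
      rcases eq_or_ne z.im 0 with h0 | h0
      · simp only [h0, abs_zero, mul_zero, zero_div, zero_mul]; positivity
      · have := abs_pos.2 h0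
        calc 2 * |z.im| / R ^ 3 * ‖f z‖ ≤ 2 * |z.im| / R ^ 3 * (M * |z.im|⁻¹) := by
              gcongr; exact hf z hz' h0
          _ = 2 * M / R ^ 3 := by field_simp)
  refine h.trans_eq ?_
  field_simp

theorem continuousOn_kernel {R : ℝ} (hR : 0 < R) :
    ContinuousOn (fun z : ℂ => (z ^ 2)⁻¹) (sphere 0 R) := by
  refine (continuous_id.pow 2).continuousOn.inv₀ fun z hz => ?_
  have : ‖z‖ = R := by simpa using hz
  exact pow_ne_zero 2 (norm_pos_iff.1 (this ▸ hR))

theorem ContinuousLinearMap.realVanishingCauchyIntegral_comp [CompleteSpace F] [CompleteSpace G]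
    {R : ℝ} (hR : 0 < R) (L : F →L[ℂ] G) {f : ℂ → F} (hf : ContinuousOn f (sphere 0 R)) :
    L (realVanishingCauchyIntegral R f) = realVanishingCauchyIntegral R fun z => L (f z) := by
  rw [realVanishingCauchyIntegral, realVanishingCauchyIntegral, map_smul]
  congr 1
  have hi : CircleIntegrable (fun z : ℂ => ((z ^ 2)⁻¹ - ((R : ℂ) ^ 2)⁻¹) • f z) 0 R :=
    (((continuousOn_kernel hR).sub continuousOn_const).smul hf).circleIntegrable hR.le
  have hi' := hi.out
  rw [circleIntegral, circleIntegral, ← L.intervalIntegral_comp_comm hi']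
  simp only [map_smul]

theorem realVanishingCauchyIntegral_eq_deriv [CompleteSpace F] {R : ℝ} (hR : 0 < R) {U : Set ℂ}
    (hU : IsOpen U) (hRU : closedBall 0 R ⊆ U) {f : ℂ → F} (hf : DifferentiableOn ℂ f U) :
    realVanishingCauchyIntegral R f = deriv f 0 := by
  have h1 := two_pi_I_inv_smul_circleIntegral_sub_sq_inv_smul_of_differentiable hU hRU hf
    (mem_ball_self hR)
  simp only [sub_zero] at h1
  have hfs : ContinuousOn f (sphere 0 R) :=
    hf.continuousOn.mono (sphere_subset_closedBall.trans hRU)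
  have h2 : (∮ z in C(0, R), f z) = 0 :=
    circleIntegral_eq_zero_of_differentiable_on_off_countable hR.le Set.countable_empty
      (hf.continuousOn.mono hRU) fun z hz =>
        (hf z (hRU (ball_subset_closedBall hz.1))).differentiableAt
          (hU.mem_nhds (hRU (ball_subset_closedBall hz.1)))
  rw [realVanishingCauchyIntegral, ← h1]
  congr 1
  simp only [sub_smul]
  rw [circleIntegral.integral_sub, circleIntegral.integral_smul, h2, smul_zero, sub_zero]
  · exact ((continuousOn_kernel hR).smul hfs).circleIntegrable hR.le
  · exact (continuousOn_const.smul hfs).circleIntegrable hR.le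

end WeightedCircleIntegral

section Polynomials

open Polynomial

theorem Polynomial.aeval_apply_of_semiconj {V W : Type*} [AddCommGroup V] [Module ℂ V]
    [AddCommGroup W] [Module ℂ W] {A : Module.End ℂ W} {B : Module.End ℂ V} {L : V →ₗ[ℂ] W}
    (h : ∀ x, A (L x) = L (B x)) (p : ℂ[X]) (x : V) :
    aeval A p (L x) = L (aeval B p x) := by
  have hpow : ∀ (n : ℕ) (x : V), (A ^ n) (L x) = L ((B ^ n) x) := by
    intro n
    induction n with
    | zero => simp
    | succ n ih => intro x; rw [pow_succ, pow_succ, Module.End.mul_apply, h, ih]; rfl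
  induction p using Polynomial.induction_on' with
  | add p q hp hq => simp [hp, hq]
  | monomial n a => simp [aeval_monomial, hpow, Module.algebraMap_end_apply]

theorem ContinuousLinearMap.aeval_apply_eq {X : Type*} [NormedAddCommGroup X] [NormedSpace ℂ X]
    (T : X →L[ℂ] X) (p : ℂ[X]) (x : X) :
    aeval T p x = aeval (T.toLinearMap : Module.End ℂ X) p x := by
  have hpow : ∀ (n : ℕ) (x : X), (T ^ n) x = ((T.toLinearMap : Module.End ℂ X) ^ n) x := by
    intro n
    induction n with
    | zero => simp
    | succ n ih => intro x; rw [pow_succ, pow_succ, mul_apply_eq_comp, ih]; rfl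
  induction p using Polynomial.induction_on' with
  | add p q hp hq => simp [hp, hq]
  | monomial n a =>
    simp [aeval_monomial, hpow, Algebra.algebraMap_eq_smul_one]

end Polynomials

section InvariantSubspace

open Polynomial

variable {X : Type*} [NormedAddCommGroup X] [NormedSpace ℂ X]
  {T : X →L[ℂ] X} {E : Submodule ℂ X}

/-- The operator induced by `T` on the quotient by an invariant subspace. -/
noncomputable def invariantQuotient (T : X →L[ℂ] X) (E : Submodule ℂ X) (hE : ∀ x ∈ E, T x ∈ E) :
    X ⧸ E →L[ℂ] X ⧸ E :=
  E.liftQL (E.mkQL ∘L T) fun x hx => by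
    simpa using hE x hx

@[simp]
theorem invariantQuotient_mk (hE : ∀ x ∈ E, T x ∈ E) (x : X) :
    invariantQuotient T E hE (E.mkQ x) = E.mkQ (T x) := by
  simp [invariantQuotient]

theorem isCompactOperator_invariantQuotient (hE : ∀ x ∈ E, T x ∈ E) (hT : IsCompactOperator T) :
    IsCompactOperator (invariantQuotient T E hE) := by
  obtain ⟨K, hK, hKT⟩ := hT
  refine ⟨E.mkQ '' K, hK.image E.mkQL.continuous, ?_⟩
  have := E.isOpenQuotientMap_mkQ.isOpenMap.image_mem_nhds hKT
  rw [map_zero] at this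
  refine Filter.mem_of_superset this ?_
  rintro _ ⟨x, hx, rfl⟩
  exact ⟨T x, hx, (invariantQuotient_mk hE x).symm⟩

theorem notMem_spectrum_invariantQuotient [CompleteSpace X] [IsClosed (E : Set X)]
    (hE : ∀ x ∈ E, T x ∈ E) (hT : IsCompactOperator T) {μ : ℂ} (hμ0 : μ ≠ 0)
    (hμ : ∀ x, T x - μ • x ∈ E → x ∈ E) : μ ∉ spectrum ℂ (invariantQuotient T E hE) := by
  rw [← (isCompactOperator_invariantQuotient hE hT).hasEigenvalue_iff_mem_spectrum hμ0]
  intro h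
  obtain ⟨y, hy⟩ := h.exists_hasEigenvector
  obtain ⟨x, rfl⟩ := E.mkQ_surjective y
  refine hy.2 ?_
  have h1 : invariantQuotient T E hE (E.mkQ x) = μ • E.mkQ x := hy.apply_eq_smul
  rw [invariantQuotient_mk, ← map_smul, ← sub_eq_zero, ← map_sub] at h1
  rw [Submodule.mkQ_apply, Submodule.Quotient.mk_eq_zero] at h1 ⊢
  exact hμ x h1

/-- The spectral projection onto a finite-dimensional invariant subspace which is spectrally
separated from the quotient. -/
theorem exists_commuting_projection [CompleteSpace X] [FiniteDimensional ℂ E]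
    (hE : ∀ x ∈ E, T x ∈ E) (hT : IsCompactOperator T)
    (hsep : ∀ μ : ℂ, (∃ x ∈ E, x ≠ 0 ∧ T x = μ • x) →
      μ ≠ 0 ∧ ∀ x, T x - μ • x ∈ E → x ∈ E) :
    ∃ P : X →L[ℂ] E, (∀ x : E, P x = x) ∧ ∀ x, (P (T x) : X) = T (P x) := by
  have hcl : IsClosed (E : Set X) := E.closed_of_finiteDimensional
  set TE : Module.End ℂ E := T.toLinearMap.restrict hE with hTE
  set q : ℂ[X] := minpoly ℂ TE with hq
  set T' := invariantQuotient T E hE with hT'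
  have hqE : ∀ x ∈ E, aeval T q x = 0 := by
    intro x hx
    rw [ContinuousLinearMap.aeval_apply_eq]
    have := Polynomial.aeval_apply_of_semiconj (A := (T.toLinearMap : Module.End ℂ X)) (B := TE)
      (L := E.subtype) (fun y => rfl) q ⟨x, hx⟩
    rw [hq, minpoly.aeval] at this
    simpa using this
  have hqmk : ∀ x, aeval T' q (E.mkQ x) = E.mkQ (aeval T q x) := by
    intro x
    rw [ContinuousLinearMap.aeval_apply_eq, ContinuousLinearMap.aeval_apply_eq]
    exact Polynomial.aeval_apply_of_semiconj (fun y => invariantQuotient_mk hE y) q x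
  have hunit : IsUnit (aeval T' q) := by
    rcases subsingleton_or_nontrivial (X ⧸ E) with h | h
    · have : aeval T' q = 1 := by ext y; exact Subsingleton.elim _ _
      rw [this]; exact isUnit_one
    by_contra hu
    have h0 : (0 : ℂ) ∈ spectrum ℂ (aeval T' q) := by rwa [spectrum.zero_mem_iff]
    rw [spectrum.map_polynomial_aeval T' q] at h0
    obtain ⟨μ, hμ, hroot⟩ := h0
    have hev : TE.HasEigenvalue μ := Module.End.hasEigenvalue_iff_isRoot.2 hroot
    obtain ⟨x, hx⟩ := hev.exists_hasEigenvector
    obtain ⟨hμ0, hμE⟩ := hsep μ ⟨x, x.2, by simpa using hx.2, congrArg Subtype.val hx.apply_eq_smul⟩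
    exact notMem_spectrum_invariantQuotient hE hT hμ0 hμE hμ
  obtain ⟨u, hu⟩ := hunit
  set V : X ⧸ E →L[ℂ] X ⧸ E := ↑u⁻¹ with hV
  have huV : ∀ y, aeval T' q (V y) = y := fun y => by
    have : (↑u * ↑u⁻¹ : X ⧸ E →L[ℂ] X ⧸ E) = 1 := u.mul_inv
    rw [hu] at this
    exact congrArg (fun L : X ⧸ E →L[ℂ] X ⧸ E => L y) this
  have hcomm : ∀ y, V (T' y) = T' (V y) := by
    have h1 : Commute T' (u : X ⧸ E →L[ℂ] X ⧸ E) := by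
      rw [hu]
      have := (Polynomial.commute_X q).map (aeval (R := ℂ) T')
      simpa using this
    intro y
    exact (congrArg (fun L : X ⧸ E →L[ℂ] X ⧸ E => L y) h1.units_inv_right.eq).symm
  set N : X ⧸ E →L[ℂ] X := E.liftQL (aeval T q) fun x hx => hqE x hx with hN
  have hNmk : ∀ x, N (E.mkQ x) = aeval T q x := fun x => rfl
  have hmkN : ∀ y, E.mkQ (N y) = aeval T' q y := by
    intro y
    obtain ⟨x, rfl⟩ := E.mkQ_surjective y
    rw [hNmk, hqmk]
  have hTN : ∀ y, T (N y) = N (T' y) := by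
    intro y
    obtain ⟨x, rfl⟩ := E.mkQ_surjective y
    rw [hNmk, invariantQuotient_mk, hNmk]
    have h1 : Commute T (aeval T q) := by
      have := (Polynomial.commute_X q).map (aeval (R := ℂ) T)
      simpa using this
    exact congrArg (fun L : X →L[ℂ] X => L x) h1.eq
  let P₀ : X →L[ℂ] X := 1 - N ∘L V ∘L E.mkQL
  have hP₀ : ∀ x, P₀ x = x - N (V (E.mkQ x)) := fun x => by simp [P₀]
  have hmem : ∀ x, P₀ x ∈ E := by
    intro x
    rw [← Submodule.Quotient.mk_eq_zero, ← Submodule.mkQ_apply, hP₀, map_sub, hmkN, huV, sub_self]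
  refine ⟨P₀.codRestrict E hmem, fun x => Subtype.ext ?_, fun x => ?_⟩
  · have : E.mkQ (x : X) = 0 := by simp
    change P₀ x = x
    rw [hP₀, this, map_zero, map_zero, sub_zero]
  · change P₀ (T x) = T (P₀ x)
    rw [hP₀, hP₀, map_sub, hTN, ← hcomm, invariantQuotient_mk]

end InvariantSubspace

section Bounds

open Metric

universe u

variable {X : Type*} [NormedAddCommGroup X] [NormedSpace ℂ X]

theorem kolmogorovDiameter_le_approxNumber (T : X →L[ℂ] X) (n : ℕ) :
    kolmogorovDiameter T n ≤ approxNumber T n := by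
  refine le_csInf ⟨_, 0, by simp, rfl⟩ ?_
  rintro _ ⟨A, hA, rfl⟩
  have hbdd : BddBelow {c : ℝ | ∃ G : Submodule ℂ X, Module.rank ℂ G ≤ (n : Cardinal) ∧
      c = ‖(quotMapL G).comp T‖} := ⟨0, by
    rintro _ ⟨G, -, rfl⟩; exact norm_nonneg ((quotMapL G).comp T)⟩
  refine (csInf_le hbdd ⟨LinearMap.range A.toLinearMap, hA, rfl⟩).trans ?_
  refine ContinuousLinearMap.opNorm_le_bound _ (norm_nonneg _) fun x => ?_
  set G := LinearMap.range A.toLinearMap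
  have h : quotMapL G (T x) = G.mkQ ((T - A) x) := by
    have hA0 : G.mkQ (A x) = 0 := by
      rw [Submodule.mkQ_apply, Submodule.Quotient.mk_eq_zero]
      exact ⟨x, rfl⟩
    change G.mkQ (T x) = _
    rw [sub_apply, map_sub, hA0, sub_zero]
  rw [ContinuousLinearMap.comp_apply, h]
  exact (Submodule.Quotient.norm_mk_le G _).trans ((T - A).le_opNorm x)

theorem approxNumber_le_norm_sub {T A : X →L[ℂ] X} {n : ℕ}
    (hA : Module.rank ℂ (LinearMap.range A.toLinearMap) ≤ (n : Cardinal)) :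
    approxNumber T n ≤ ‖T - A‖ :=
  csInf_le ⟨0, by rintro _ ⟨G, -, rfl⟩; exact norm_nonneg _⟩ ⟨A, hA, rfl⟩

/-- A functional vanishing on `G` is controlled by the quotient norm modulo `G`. -/
theorem norm_comp_le_of_vanishing (T : X →L[ℂ] X) {G : Submodule ℂ X} {φ : X →L[ℂ] ℂ}
    (hφ : ∀ x ∈ G, φ x = 0) : ‖φ.comp T‖ ≤ ‖φ‖ * ‖(quotMapL G).comp T‖ := by
  refine ContinuousLinearMap.opNorm_le_bound _ (by positivity) fun x => ?_
  have key : ∀ y, ‖φ y‖ ≤ ‖φ‖ * ‖quotMapL G y‖ := by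
    intro y
    refine le_of_forall_pos_le_add fun ε hε => ?_
    obtain ⟨m, hm, hmε⟩ := Submodule.Quotient.norm_mk_lt (S := G) (quotMapL G y)
      (show 0 < ε / (‖φ‖ + 1) by positivity)
    have hmem : y - m ∈ G := by
      rw [← Submodule.Quotient.mk_eq_zero, Submodule.Quotient.mk_sub, hm, sub_eq_zero]
      rfl
    have hym : φ y = φ m := by simpa [sub_eq_zero] using hφ _ hmem
    calc ‖φ y‖ ≤ ‖φ‖ * ‖m‖ := hym ▸ φ.le_opNorm m
      _ ≤ ‖φ‖ * (‖quotMapL G y‖ + ε / (‖φ‖ + 1)) := by gcongr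
      _ = ‖φ‖ * ‖quotMapL G y‖ + ε * (‖φ‖ / (‖φ‖ + 1)) := by ring
      _ ≤ ‖φ‖ * ‖quotMapL G y‖ + ε * 1 := by
        gcongr
        rw [div_le_one (by positivity)]
        linarith
      _ = _ := by rw [mul_one]
  calc ‖φ (T x)‖ ≤ ‖φ‖ * ‖quotMapL G (T x)‖ := key _
    _ ≤ ‖φ‖ * (‖(quotMapL G).comp T‖ * ‖x‖) := by
      gcongr; exact ((quotMapL G).comp T).le_opNorm x
    _ = _ := by ring

theorem isUnit_one_sub_smul {A : Type*} [Ring A] [Algebra ℂ A] {a : A} {w : ℂ}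
    (hw : w ≠ 0 → w⁻¹ ∉ spectrum ℂ a) : IsUnit (1 - w • a) := by
  rcases eq_or_ne w 0 with rfl | h0
  · simp
  have h := spectrum.notMem_iff.1 (hw h0)
  have h1 : 1 - w • a = Units.mk0 w h0 • (algebraMap ℂ A w⁻¹ - a) := by
    rw [Units.smul_mk0, smul_sub, Algebra.algebraMap_eq_smul_one, smul_smul, mul_inv_cancel₀ h0,
      one_smul]
  rw [h1]
  exact h.smul _

theorem isOpen_setOf_isUnit_sub_smul {A : Type*} [NormedRing A] [NormedAlgebra ℂ A]
    [CompleteSpace A] (a b : A) : IsOpen {w : ℂ | IsUnit (a - w • b)} :=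
  Units.isOpen.preimage (f := fun w : ℂ => a - w • b) (by fun_prop)

theorem differentiableAt_ringInverse_sub_smul {A : Type*} [NormedRing A] [NormedAlgebra ℂ A]
    [CompleteSpace A] {a b : A} {w : ℂ} (hw : IsUnit (a - w • b)) :
    DifferentiableAt ℂ (fun w : ℂ => Ring.inverse (a - w • b)) w :=
  (differentiableAt_inverse (𝕜 := ℂ) hw).comp w (f := fun w : ℂ => a - w • b) (by fun_prop)

theorem ringInverse_eq_of_mul_eq_one {A : Type*} [Ring A] {a b : A} (h1 : a * b = 1)
    (h2 : b * a = 1) : Ring.inverse a = b :=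
  Ring.inverse_unit ⟨a, b, h1, h2⟩

theorem IsHOperator.norm_inverse_one_sub_smul_le {T : X →L[ℂ] X} {C : ℝ} (hH : IsHOperator T C)
    {w : ℂ} (hw : w.im ≠ 0) :
    ‖Ring.inverse (1 - w • T)‖ ≤ C * ‖w‖ * |w.im|⁻¹ := by
  have hw0 : w ≠ 0 := by rintro rfl; simp at hw
  have him : (w⁻¹).im ≠ 0 := by
    rw [Complex.inv_im]
    exact div_ne_zero (neg_ne_zero.2 hw) (Complex.normSq_pos.2 hw0).ne'
  obtain ⟨S, h1, h2, hS⟩ := hH.2 _ him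
  have heq : 1 - w • T = (-w) • (T - w⁻¹ • (1 : X →L[ℂ] X)) := by
    rw [smul_sub, smul_smul, neg_mul, mul_inv_cancel₀ hw0]; module
  have hinv : Ring.inverse (1 - w • T) = (-w)⁻¹ • S := by
    refine ringInverse_eq_of_mul_eq_one ?_ ?_
    · rw [heq, smul_mul_smul_comm, mul_inv_cancel₀ (neg_ne_zero.2 hw0), one_smul]; exact h2
    · rw [heq, smul_mul_smul_comm, inv_mul_cancel₀ (neg_ne_zero.2 hw0), one_smul]; exact h1
  have hn : 0 < ‖w‖ := norm_pos_iff.2 hw0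
  have hi : 0 < |w.im| := abs_pos.2 hw
  rw [hinv, norm_smul, norm_inv, norm_neg]
  calc ‖w‖⁻¹ * ‖S‖ ≤ ‖w‖⁻¹ * (C * |(w⁻¹).im|⁻¹) := by gcongr
    _ = C * ‖w‖ * |w.im|⁻¹ := by
      rw [Complex.inv_im, abs_div, abs_neg, Complex.normSq_eq_norm_sq, abs_of_pos (pow_pos hn 2)]
      field_simp

theorem deriv_ringInverse_one_sub_smul {A : Type*} [NormedRing A] [NormedAlgebra ℂ A]
    [CompleteSpace A] (a : A) : deriv (fun w : ℂ => Ring.inverse (1 - w • a)) 0 = a := by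
  have h1 : HasDerivAt (fun w : ℂ => 1 - w • a) (-a) 0 := by
    simpa using ((hasDerivAt_id (0 : ℂ)).smul_const a).const_sub 1
  have h2 := hasFDerivAt_ringInverse (𝕜 := ℂ) (1 : Aˣ)
  have h3 := HasFDerivAt.comp_hasDerivAt_of_eq (0 : ℂ) h2 h1 (by simp)
  simpa [Function.comp_def] using h3.deriv

/-- If `T` is intertwined by `q` with an operator `S` whose spectrum lies in the open disc of
radius `r`, then `T` agrees on `q` with an operator of norm `≤ 2 * C * r`. -/
theorem IsHOperator.exists_comp_eq_norm_le [CompleteSpace X] {Y : Type*} [NormedAddCommGroup Y]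
    [NormedSpace ℂ Y] [CompleteSpace Y] {T : X →L[ℂ] X} {C : ℝ} (hC : 0 ≤ C)
    (hH : IsHOperator T C) {q : X →L[ℂ] Y} {S : Y →L[ℂ] Y} (hq : ∀ x, q (T x) = S (q x))
    {r : ℝ} (hr : 0 < r) (hrT : ∀ μ ∈ spectrum ℂ T, ‖μ‖ ≠ r)
    (hrS : ∀ μ ∈ spectrum ℂ S, ‖μ‖ < r) :
    ∃ B : X →L[ℂ] X, (∀ x, q (B x) = q (T x)) ∧ ‖B‖ ≤ 2 * C * r := by
  have hR : 0 < r⁻¹ := inv_pos.2 hr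
  set f : ℂ → X →L[ℂ] X := fun w => Ring.inverse (1 - w • T) with hf
  set g : ℂ → Y →L[ℂ] Y := fun w => Ring.inverse (1 - w • S) with hg
  have hfu : ∀ w ∈ sphere (0 : ℂ) r⁻¹, IsUnit (1 - w • T) := by
    intro w hw
    refine isUnit_one_sub_smul fun _ hmem => hrT _ hmem ?_
    rw [norm_inv, mem_sphere_zero_iff_norm.1 hw, inv_inv]
  have hgu : ∀ w ∈ closedBall (0 : ℂ) r⁻¹, IsUnit (1 - w • S) := by
    intro w hw
    refine isUnit_one_sub_smul fun h0 hmem => (hrS _ hmem).not_ge ?_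
    rw [norm_inv]
    exact (le_inv_comm₀ hr (norm_pos_iff.2 h0)).2 (mem_closedBall_zero_iff.1 hw)
  have hfc : ContinuousOn f (sphere 0 r⁻¹) := fun w hw =>
    (differentiableAt_ringInverse_sub_smul (hfu w hw)).continuousAt.continuousWithinAt
  set U : Set ℂ := {w | IsUnit (1 - w • S)} with hU
  have hUo : IsOpen U := isOpen_setOf_isUnit_sub_smul 1 S
  have hgd : DifferentiableOn ℂ g U := fun w hw =>
    (differentiableAt_ringInverse_sub_smul (a := 1) (b := S) hw).differentiableWithinAt
  have hgc : ContinuousOn g (sphere 0 r⁻¹) :=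
    hgd.continuousOn.mono (sphere_subset_closedBall.trans hgu)
  refine ⟨realVanishingCauchyIntegral r⁻¹ f, fun x => ?_, ?_⟩
  · have hint : ∀ w ∈ sphere (0 : ℂ) r⁻¹, q ∘L f w = g w ∘L q := by
      intro w hw
      have h1 : q ∘L (1 - w • T) = (1 - w • S) ∘L q := by
        ext x
        simp [hq]
      have h2 : (1 - w • T) ∘L f w = 1 := Ring.mul_inverse_cancel _ (hfu w hw)
      have h3 : g w ∘L (1 - w • S) = 1 :=
        Ring.inverse_mul_cancel _ (hgu w (sphere_subset_closedBall hw))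
      calc q ∘L f w = (g w ∘L (1 - w • S)) ∘L q ∘L f w := by rw [h3]; rfl
        _ = g w ∘L ((1 - w • S) ∘L q) ∘L f w := rfl
        _ = g w ∘L q ∘L ((1 - w • T) ∘L f w) := by rw [← h1]; rfl
        _ = g w ∘L q := by rw [h2]; rfl
    have h1 := ContinuousLinearMap.realVanishingCauchyIntegral_comp hR
      (ContinuousLinearMap.compL ℂ X X Y q) hfc
    have h2 := ContinuousLinearMap.realVanishingCauchyIntegral_comp hR
      ((ContinuousLinearMap.compL ℂ X Y Y).flip q) hgc
    rw [realVanishingCauchyIntegral_eq_deriv hR hUo hgu hgd, hg,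
      deriv_ringInverse_one_sub_smul] at h2
    have h3 : realVanishingCauchyIntegral r⁻¹ (fun z => q ∘L f z) =
        realVanishingCauchyIntegral r⁻¹ (fun z => g z ∘L q) := by
      rw [realVanishingCauchyIntegral, realVanishingCauchyIntegral]
      congr 1
      exact circleIntegral.integral_congr hR.le fun z hz => by
        simp only [hint z hz]
    rw [hq]
    exact congrArg (fun L : X →L[ℂ] Y => L x) ((h1.trans h3).trans h2.symm)
  · have := norm_realVanishingCauchyIntegral_le (f := f) hR (M := C * r⁻¹) (by positivity)
      (fun z hz him => hz ▸ hH.norm_inverse_one_sub_smul_le him)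
    refine this.trans_eq ?_
    field_simp

/-- The distance to the operators of rank `≤ n` is controlled by any radius outside which the
spectrum is exhausted by a spectral subspace of dimension `≤ n`. -/
theorem approxNumber_le_of_separating_radius [CompleteSpace X] {T : X →L[ℂ] X} {C : ℝ}
    (hC : 0 ≤ C) (hH : IsHOperator T C) (hT : IsCompactOperator T) {E : Submodule ℂ X}
    [FiniteDimensional ℂ E] (hE : ∀ x ∈ E, T x ∈ E) {n : ℕ} (hn : Module.finrank ℂ E ≤ n)
    {r : ℝ} (hr : 0 < r) (hrT : ∀ μ ∈ spectrum ℂ T, ‖μ‖ ≠ r)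
    (hrE : ∀ μ : ℂ, r ≤ ‖μ‖ → ∀ x, T x - μ • x ∈ E → x ∈ E) :
    approxNumber T n ≤ 2 * C * r := by
  have hcl : IsClosed (E : Set X) := E.closed_of_finiteDimensional
  obtain ⟨B, hB, hBr⟩ := hH.exists_comp_eq_norm_le hC (q := E.mkQL)
    (S := invariantQuotient T E hE) (fun x => (invariantQuotient_mk hE x).symm) hr hrT
    (fun μ hμ => lt_of_not_ge fun h => notMem_spectrum_invariantQuotient hE hT
      (norm_pos_iff.1 (hr.trans_le h)) (hrE μ h) hμ)
  have hrange : LinearMap.range (T - B).toLinearMap ≤ E := by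
    rintro _ ⟨x, rfl⟩
    rw [← Submodule.Quotient.mk_eq_zero]
    change E.mkQ (T x - B x) = 0
    rw [map_sub, sub_eq_zero]
    exact (hB x).symm
  have hrank : Module.rank ℂ (LinearMap.range (T - B).toLinearMap) ≤ (n : Cardinal) := by
    refine (Submodule.rank_mono hrange).trans ?_
    rw [← Module.finrank_eq_rank]
    exact_mod_cast hn
  have := approxNumber_le_norm_sub (T := T) hrank
  rw [sub_sub_cancel] at this
  exact this.trans hBr

/-- If a projection onto a space of dimension `> dim G` intertwines `T` with an operator whose
spectrum lies outside the closed disc of radius `r`, then `T` is not small modulo `G`. -/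
theorem IsHOperator.le_norm_quotMapL_comp {X F : Type u} [NormedAddCommGroup X]
    [NormedSpace ℂ X] [NormedAddCommGroup F] [NormedSpace ℂ F] [FiniteDimensional ℂ F]
    {T : X →L[ℂ] X} {C : ℝ} (hC : 0 ≤ C) (hH : IsHOperator T C) {P : X →L[ℂ] F}
    (hP : Function.Surjective P) {S : F →L[ℂ] F} (hPT : ∀ x, P (T x) = S (P x)) {n : ℕ}
    (hn : n < Module.finrank ℂ F) {r : ℝ} (hr : 0 < r)
    (hrS : ∀ z : ℂ, ‖z‖ ≤ r → ∀ x, S x = z • x → x = 0)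
    {G : Submodule ℂ X} (hG : Module.rank ℂ G ≤ (n : Cardinal)) :
    r ≤ 2 * C * ‖(quotMapL G).comp T‖ := by
  have : CompleteSpace F := FiniteDimensional.complete ℂ F
  have hu : ∀ z : ℂ, ‖z‖ ≤ r → IsUnit (S - z • (1 : F →L[ℂ] F)) := by
    intro z hz
    rw [ContinuousLinearMap.isUnit_iff_bijective]
    have hinj : Function.Injective (S - z • (1 : F →L[ℂ] F)) := by
      rw [injective_iff_map_eq_zero]
      intro x hx
      exact hrS z hz x (sub_eq_zero.1 hx)
    exact ⟨hinj, (LinearMap.injective_iff_surjective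
      (f := (S - z • (1 : F →L[ℂ] F)).toLinearMap)).1 hinj⟩
  have hlt : G.map P.toLinearMap < ⊤ := by
    refine lt_top_iff_ne_top.2 fun htop => hn.not_ge ?_
    have h1 : Module.rank ℂ (G.map P.toLinearMap) ≤ (n : Cardinal) :=
      (rank_map_le _ _).trans hG
    rw [htop, rank_top, ← Module.finrank_eq_rank] at h1
    exact_mod_cast h1
  obtain ⟨ψ₀, hψ₀, hker⟩ := Submodule.exists_le_ker_of_lt_top _ hlt
  set ψ : F →L[ℂ] ℂ := LinearMap.toContinuousLinearMap ψ₀ with hψ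
  set φ : X →L[ℂ] ℂ := ψ ∘L P with hφ
  have hφ0 : φ ≠ 0 := by
    intro h
    refine hψ₀ (LinearMap.ext fun y => ?_)
    obtain ⟨x, rfl⟩ := hP y
    exact congrArg (fun L : X →L[ℂ] ℂ => L x) h
  have hφG : ∀ x ∈ G, φ x = 0 := fun x hx => hker ⟨x, hx, rfl⟩
  set V : ℂ → F →L[ℂ] F := fun z => Ring.inverse (S - z • (1 : F →L[ℂ] F)) with hV
  set g : ℂ → X →L[ℂ] ℂ := fun z => (ψ ∘L S) ∘L V z ∘L P with hg
  set U : Set ℂ := {z | IsUnit (S - z • (1 : F →L[ℂ] F))} with hU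
  have hUo : IsOpen U := isOpen_setOf_isUnit_sub_smul S 1
  have hgd : ∀ z ∈ U, DifferentiableAt ℂ g z := by
    intro z hz
    have h1 : DifferentiableAt ℂ V z :=
      differentiableAt_ringInverse_sub_smul (a := S) (b := 1) hz
    exact (differentiableAt_const _).clm_comp (h1.clm_comp (differentiableAt_const _))
  have hfd : DifferentiableOn ℂ (fun z => z • g z) U := fun z hz =>
    (differentiableAt_id.smul (hgd z hz)).differentiableWithinAt
  have hrU : closedBall (0 : ℂ) r ⊆ U := fun z hz => hu z (mem_closedBall_zero_iff.1 hz)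
  have hg0 : g 0 = φ := by
    have h1 : S * V 0 = 1 := by
      have := Ring.mul_inverse_cancel _ (hu 0 (by simpa using hr.le))
      simpa [hV] using this
    change ψ ∘L (S * V 0) ∘L P = φ
    rw [h1]
    rfl
  have hderiv : deriv (fun z => z • g z) 0 = φ := by
    have h1 := (hasDerivAt_id' (0 : ℂ)).fun_smul
      (hgd 0 (hrU (mem_closedBall_self hr.le))).hasDerivAt
    refine h1.deriv.trans ?_
    ext x
    change (0 : ℂ) * deriv g 0 x + 1 * g 0 x = φ x
    rw [zero_mul, one_mul, zero_add, hg0]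
  have hbound : ∀ z : ℂ, ‖z‖ = r → z.im ≠ 0 →
      ‖z • g z‖ ≤ (r * (‖φ ∘L T‖ * C)) * |z.im|⁻¹ := by
    intro z hz him
    obtain ⟨W, -, h2, hW⟩ := hH.2 z him
    have h3 : V z ∘L (S - z • (1 : F →L[ℂ] F)) = 1 := Ring.inverse_mul_cancel _ (hu z hz.le)
    have h4 : (S - z • (1 : F →L[ℂ] F)) ∘L P = P ∘L (T - z • (1 : X →L[ℂ] X)) := by
      ext x
      simp [hPT]
    have h5 : V z ∘L P = P ∘L W := by
      calc V z ∘L P = V z ∘L (P ∘L ((T - z • (1 : X →L[ℂ] X)) ∘L W)) := by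
            rw [h2]; rfl
        _ = V z ∘L (P ∘L (T - z • (1 : X →L[ℂ] X))) ∘L W := rfl
        _ = (V z ∘L (S - z • (1 : F →L[ℂ] F))) ∘L P ∘L W := by rw [← h4]; rfl
        _ = P ∘L W := by rw [h3]; rfl
    have h6 : g z = (φ ∘L T) ∘L W := by
      change (ψ ∘L S) ∘L (V z ∘L P) = _
      rw [h5]
      ext x
      simp [hφ, hPT]
    rw [norm_smul, hz, h6]
    calc r * ‖(φ ∘L T) ∘L W‖ ≤ r * (‖φ ∘L T‖ * ‖W‖) := by
          gcongr; exact ContinuousLinearMap.opNorm_comp_le _ _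
      _ ≤ r * (‖φ ∘L T‖ * (C * |z.im|⁻¹)) := by gcongr
      _ = _ := by ring
  have h1 := norm_realVanishingCauchyIntegral_le hr (by positivity) hbound
  rw [realVanishingCauchyIntegral_eq_deriv hr hUo hrU hfd, hderiv] at h1
  have h2 := norm_comp_le_of_vanishing T hφG
  have hφpos : 0 < ‖φ‖ := norm_pos_iff.2 hφ0
  have h3 : ‖φ‖ * r ≤ ‖φ‖ * (2 * C * ‖(quotMapL G).comp T‖) := by
    calc ‖φ‖ * r ≤ 2 * (r * (‖φ ∘L T‖ * C)) / r ^ 2 * r := by gcongr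
      _ = 2 * C * ‖φ ∘L T‖ := by field_simp
      _ ≤ 2 * C * (‖φ‖ * ‖(quotMapL G).comp T‖) := by gcongr
      _ = _ := by ring
  exact le_of_mul_le_mul_left h3 hφpos

end Bounds

section Enumeration

open Module

variable {X : Type*} [NormedAddCommGroup X] [NormedSpace ℂ X] {T : X →L[ℂ] X} {lam : ℕ → ℂ}

theorem algebraicMultiplicity_eq_finrank (T : X →L[ℂ] X) (μ : ℂ) :
    algebraicMultiplicity T μ = finrank ℂ (End.maxGenEigenspace T.toLinearMap μ) := by
  have h : ∀ (k : ℕ) (x : X), ((T - μ • (1 : X →L[ℂ] X)) ^ k) x =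
      ((T.toLinearMap - μ • (1 : End ℂ X)) ^ k) x := by
    intro k
    induction k with
    | zero => intro x; rfl
    | succ k ih => intro x; rw [pow_succ, pow_succ]; exact ih _
  have hsup : (⨆ k : ℕ, LinearMap.ker ((T - μ • (1 : X →L[ℂ] X)) ^ k).toLinearMap : Submodule ℂ X) =
      End.maxGenEigenspace T.toLinearMap μ := by
    rw [← End.iSup_genEigenspace_eq]
    refine iSup_congr fun k => ?_
    ext x
    rw [End.mem_genEigenspace_nat, LinearMap.mem_ker, LinearMap.mem_ker, ← h]
    rfl
  rw [algebraicMultiplicity, hsup]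

namespace IsEigenvalueEnumeration

theorem norm_antitone (hlam : IsEigenvalueEnumeration T lam) : Antitone fun n => ‖lam n‖ :=
  antitone_nat_of_succ_le hlam.1

theorem finiteDimensional_maxGenEigenspace (hlam : IsEigenvalueEnumeration T lam) {k : ℕ}
    (hk : lam k ≠ 0) : FiniteDimensional ℂ (End.maxGenEigenspace T.toLinearMap (lam k)) := by
  obtain ⟨hfin, hcard⟩ := hlam.2.2.1 _ hk
  rw [algebraicMultiplicity_eq_finrank] at hcard
  refine Module.finite_of_finrank_pos ?_
  rw [← hcard, Set.ncard_pos hfin]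
  exact ⟨k, rfl⟩

theorem finrank_genEigenspan (hlam : IsEigenvalueEnumeration T lam) {S : Finset ℂ}
    (hS : ∀ μ ∈ S, μ ≠ 0 ∧ ∃ k, lam k = μ) :
    {k | lam k ∈ S}.Finite ∧
      finrank ℂ (genEigenspan (T.toLinearMap : End ℂ X) S) = {k | lam k ∈ S}.ncard := by
  have hfin : {k | lam k ∈ S}.Finite := by
    have : {k | lam k ∈ S} = ⋃ μ ∈ S, {k | lam k = μ} := by ext; simp
    rw [this]
    exact S.finite_toSet.biUnion fun μ hμ => (hlam.2.2.1 μ (hS μ hμ).1).1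
  refine ⟨hfin, ?_⟩
  rw [_root_.finrank_genEigenspan, Set.ncard_eq_toFinset_card _ hfin,
    Finset.card_eq_sum_card_fiberwise (f := lam) (t := S) (fun k hk => by simpa using hk)]
  · refine Finset.sum_congr rfl fun μ hμ => ?_
    rw [← algebraicMultiplicity_eq_finrank, ← (hlam.2.2.1 μ (hS μ hμ).1).2,
      ← Set.ncard_coe_finset]
    congr 1
    ext k
    simp only [Set.mem_ofPred_eq, Finset.coe_filter, Set.Finite.mem_toFinset]
    exact ⟨fun h => ⟨h ▸ hμ, h⟩, fun h => h.2⟩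
  · intro μ hμ
    obtain ⟨h0, k, rfl⟩ := hS μ hμ
    exact hlam.finiteDimensional_maxGenEigenspace h0

theorem exists_eq_of_hasEigenvalue [CompleteSpace X] (hlam : IsEigenvalueEnumeration T lam)
    (hT : IsCompactOperator T) {μ : ℂ} (h0 : μ ≠ 0)
    (hμ : End.HasEigenvalue (T.toLinearMap : End ℂ X) μ) : ∃ k, lam k = μ :=
  hlam.2.2.2 μ ((hT.hasEigenvalue_iff_mem_spectrum h0).1 hμ) h0

theorem approxNumber_le [CompleteSpace X] (hlam : IsEigenvalueEnumeration T lam)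
    {C : ℝ} (hC : 0 < C) (hH : IsHOperator T C) (hT : IsCompactOperator T) (n : ℕ) :
    approxNumber T n ≤ 2 * C * ‖lam n‖ := by
  classical
  by_contra! hlt
  have hlt' : ‖lam n‖ < approxNumber T n / (2 * C) := by
    rwa [lt_div_iff₀ (by positivity), mul_comm]
  obtain ⟨r, ⟨hnr, hr⟩, hrn⟩ := (Set.Ioo_infinite hlt').exists_notMem_finset
    ((Finset.range n).image fun k => ‖lam k‖)
  have hr0 : 0 < r := (norm_nonneg _).trans_lt hnr
  have hlt_of_le : ∀ k, r ≤ ‖lam k‖ → k < n := fun k hk => by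
    by_contra! hnk
    exact (hk.trans (hlam.norm_antitone hnk)).not_gt hnr
  set S : Finset ℂ := {k ∈ Finset.range n | r ≤ ‖lam k‖}.image lam with hSdef
  have hmem : ∀ μ, μ ∈ S ↔ r ≤ ‖μ‖ ∧ ∃ k, lam k = μ := by
    intro μ
    simp only [hSdef, Finset.mem_image, Finset.mem_filter, Finset.mem_range]
    constructor
    · rintro ⟨k, ⟨-, hk⟩, rfl⟩
      exact ⟨hk, k, rfl⟩
    · rintro ⟨hk, k, rfl⟩
      exact ⟨k, ⟨hlt_of_le k hk, hk⟩, rfl⟩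
  have hS : ∀ μ ∈ S, μ ≠ 0 ∧ ∃ k, lam k = μ := fun μ hμ =>
    ⟨norm_pos_iff.1 (hr0.trans_le ((hmem μ).1 hμ).1), ((hmem μ).1 hμ).2⟩
  have hSfin : ∀ μ ∈ S, FiniteDimensional ℂ (End.maxGenEigenspace T.toLinearMap μ) := by
    intro μ hμ
    obtain ⟨h0, k, rfl⟩ := hS μ hμ
    exact hlam.finiteDimensional_maxGenEigenspace h0
  have := finiteDimensional_genEigenspan hSfin
  have hrank : finrank ℂ (genEigenspan (T.toLinearMap : End ℂ X) S) ≤ n := by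
    rw [(hlam.finrank_genEigenspan hS).2]
    calc {k | lam k ∈ S}.ncard ≤ (Finset.range n : Set ℕ).ncard := by
          refine Set.ncard_le_ncard (fun k hk => ?_) (Finset.finite_toSet _)
          simpa using hlt_of_le k ((hmem _).1 hk).1
      _ = n := by rw [Set.ncard_coe_finset, Finset.card_range]
  have happrox : approxNumber T n ≤ 2 * C * r := by
    refine approxNumber_le_of_separating_radius hC.le hH hT
      (fun x hx => apply_mem_genEigenspan hx) hrank hr0 ?_ ?_
    · rintro μ hμ hμr
      obtain ⟨k, rfl⟩ := hlam.2.2.2 μ hμ (norm_pos_iff.1 (hμr ▸ hr0))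
      exact hrn (Finset.mem_image.2 ⟨k, Finset.mem_range.2 (hlt_of_le k hμr.ge), hμr⟩)
    · intro μ hμ x hx
      refine mem_genEigenspan_of_sub_smul_mem hSfin ?_ hx
      by_cases h : End.HasEigenvalue (T.toLinearMap : End ℂ X) μ
      · exact Or.inl ((hmem μ).2
          ⟨hμ, hlam.exists_eq_of_hasEigenvalue hT (norm_pos_iff.1 (hr0.trans_le hμ)) h⟩)
      · exact Or.inr h
  have : 2 * C * r < approxNumber T n := by
    rwa [lt_div_iff₀ (by positivity), mul_comm] at hr
  exact this.not_ge happrox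

theorem norm_le_kolmogorovDiameter [CompleteSpace X] (hlam : IsEigenvalueEnumeration T lam)
    {C : ℝ} (hC : 0 < C) (hH : IsHOperator T C) (hT : IsCompactOperator T) (n : ℕ) :
    ‖lam n‖ ≤ 2 * C * kolmogorovDiameter T n := by
  classical
  rw [← div_le_iff₀' (by positivity)]
  refine le_csInf ⟨_, ⊥, by simp, rfl⟩ ?_
  rintro _ ⟨G, hG, rfl⟩
  rw [div_le_iff₀' (by positivity)]
  refine le_of_forall_lt_imp_le_of_dense fun r hr => ?_
  rcases le_or_gt r 0 with hr0 | hr0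
  · exact hr0.trans (by positivity)
  set S : Finset ℂ := (Finset.range (n + 1)).image lam with hSdef
  have hnorm : ∀ μ ∈ S, ‖lam n‖ ≤ ‖μ‖ := by
    intro μ hμ
    obtain ⟨k, hk, rfl⟩ := Finset.mem_image.1 hμ
    exact hlam.norm_antitone (Finset.mem_range_succ_iff.1 hk)
  have hS : ∀ μ ∈ S, μ ≠ 0 ∧ ∃ k, lam k = μ := by
    intro μ hμ
    refine ⟨norm_pos_iff.1 (hr0.trans (hr.trans_le (hnorm μ hμ))), ?_⟩
    obtain ⟨k, -, hk⟩ := Finset.mem_image.1 hμ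
    exact ⟨k, hk⟩
  have hSfin : ∀ μ ∈ S, FiniteDimensional ℂ (End.maxGenEigenspace T.toLinearMap μ) := by
    intro μ hμ
    obtain ⟨h0, k, rfl⟩ := hS μ hμ
    exact hlam.finiteDimensional_maxGenEigenspace h0
  have := finiteDimensional_genEigenspan hSfin
  have hrank : n < finrank ℂ (genEigenspan (T.toLinearMap : End ℂ X) S) := by
    obtain ⟨hfin, hcard⟩ := hlam.finrank_genEigenspan hS
    rw [hcard, ← Nat.succ_le_iff]
    calc n + 1 = (Finset.range (n + 1) : Set ℕ).ncard := by
          rw [Set.ncard_coe_finset, Finset.card_range]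
      _ ≤ _ := Set.ncard_le_ncard (fun k hk => Finset.mem_image_of_mem lam hk) hfin
  have hE : ∀ x ∈ genEigenspan (T.toLinearMap : End ℂ X) S,
      T x ∈ genEigenspan (T.toLinearMap : End ℂ X) S := fun x hx => apply_mem_genEigenspan hx
  obtain ⟨P, hPE, hPT⟩ := exists_commuting_projection hE hT (by
    rintro μ ⟨x, hx, hx0, hTx⟩
    have hμ : μ ∈ S := by
      by_contra hμ
      exact hx0 (eq_zero_of_mem_genEigenspan hμ hx hTx)
    exact ⟨(hS μ hμ).1, fun y hy => mem_genEigenspan_of_sub_smul_mem hSfin (Or.inl hμ) hy⟩)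
  refine hH.le_norm_quotMapL_comp hC.le (P := P) (fun x => ⟨x, hPE x⟩)
    (S := (T ∘L Submodule.subtypeL _).codRestrict _ fun x => hE x x.2)
    (fun x => Subtype.ext (hPT x)) hrank hr0 ?_ hG
  intro z hz x hx
  have hzS : z ∉ S := fun h => (hz.trans_lt hr).not_ge (hnorm z h)
  exact Subtype.ext (eq_zero_of_mem_genEigenspan hzS x.2 (congrArg Subtype.val hx))

end IsEigenvalueEnumeration

end Enumeration

/-- **Markus' theorem.** If `T` is a compact H-operator with constant `C` on an
infinite-dimensional complex Banach space `X`, then for every `n ≥ 1`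
`δ_{n-1}(T) ≤ α_n(T) ≤ 2√2 C |λ_n(T)| ≤ 8C(C+1) δ_{n-1}(T)`.
(Here the index `n` of the statement corresponds to `n+1` below.) -/
theorem markus_inequalities {X : Type*} [NormedAddCommGroup X] [NormedSpace ℂ X]
    [CompleteSpace X] (hX : ¬ FiniteDimensional ℂ X)
    (T : X →L[ℂ] X) (C : ℝ) (hC : 1 ≤ C) (hH : IsHOperator T C)
    (hT : IsCompactOperator T) (lam : ℕ → ℂ) (hlam : IsEigenvalueEnumeration T lam)
    (n : ℕ) :
    kolmogorovDiameter T n ≤ approxNumber T n ∧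
    approxNumber T n ≤ 2 * Real.sqrt 2 * C * ‖lam n‖ ∧
    2 * Real.sqrt 2 * C * ‖lam n‖ ≤
      8 * C * (C + 1) * kolmogorovDiameter T n := by
  have hC0 : 0 < C := one_pos.trans_le hC
  have h2 : (1 : ℝ) ≤ Real.sqrt 2 := Real.one_le_sqrt.2 one_le_two
  have h2' : Real.sqrt 2 ≤ 2 := Real.sqrt_le_iff.2 ⟨by norm_num, by norm_num⟩
  have hlower := hlam.norm_le_kolmogorovDiameter hC0 hH hT n
  have hδ : 0 ≤ kolmogorovDiameter T n := by
    refine Real.sInf_nonneg ?_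
    rintro _ ⟨G, -, rfl⟩
    exact norm_nonneg ((quotMapL G).comp T)
  refine ⟨kolmogorovDiameter_le_approxNumber T n, ?_, ?_⟩
  · refine (hlam.approxNumber_le hC0 hH hT n).trans ?_
    gcongr
    linarith
  · calc 2 * Real.sqrt 2 * C * ‖lam n‖ ≤ 2 * 2 * C * (2 * C * kolmogorovDiameter T n) := by gcongr
      _ = 8 * C * C * kolmogorovDiameter T n := by ring
      _ ≤ 8 * C * (C + 1) * kolmogorovDiameter T n := by gcongr; linarith
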